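/- arXiv:2106.10755 — 4 statements merged into one kernel-verified Lean document; each statement's English description precedes it below -/
import Mathlib

section
/- For every a ≥ 0, η > 0, and x ∈ ℝ, one has (a + η²)^{-1/2} − (a + x² + η²)^{-1/2} + x² (a + x² + η²)^{-3/2} ≥ 0, with equality if and only if x = 0 (in particular the left-hand side is strictly positive for x ≠ 0). -/
/-- Nonnegativity of the diagonal entries of the difference between the approximate and the
true Hessian in the O-BTD-RLS MM step:
(a+η²)^{-1/2} − (a+x²+η²)^{-1/2} + x²(a+x²+η²)^{-3/2} ≥ 0, with equality iff x = 0. -/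
theorem approx_hessian_dominates_diagonal
    (a η x : ℝ) (ha : 0 ≤ a) (hη : 0 < η) :
    0 ≤ (Real.sqrt (a + η ^ 2))⁻¹ - (Real.sqrt (a + x ^ 2 + η ^ 2))⁻¹ +
        x ^ 2 * ((Real.sqrt (a + x ^ 2 + η ^ 2)) ^ 3)⁻¹ ∧
    ((Real.sqrt (a + η ^ 2))⁻¹ - (Real.sqrt (a + x ^ 2 + η ^ 2))⁻¹ +
        x ^ 2 * ((Real.sqrt (a + x ^ 2 + η ^ 2)) ^ 3)⁻¹ = 0 ↔ x = 0) := by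
  have h0 : 0 < a + η ^ 2 := by positivity
  have hT : 0 < a + x ^ 2 + η ^ 2 := by positivity
  have hs : 0 < Real.sqrt (a + η ^ 2) := Real.sqrt_pos.mpr h0
  have ht : 0 < Real.sqrt (a + x ^ 2 + η ^ 2) := Real.sqrt_pos.mpr hT
  have hle : Real.sqrt (a + η ^ 2) ≤ Real.sqrt (a + x ^ 2 + η ^ 2) :=
    Real.sqrt_le_sqrt (by nlinarith [sq_nonneg x])
  have h1 : (Real.sqrt (a + x ^ 2 + η ^ 2))⁻¹ ≤ (Real.sqrt (a + η ^ 2))⁻¹ :=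
    inv_anti₀ hs hle
  have h3 : 0 < ((Real.sqrt (a + x ^ 2 + η ^ 2)) ^ 3)⁻¹ := by positivity
  have h2 : 0 ≤ x ^ 2 * ((Real.sqrt (a + x ^ 2 + η ^ 2)) ^ 3)⁻¹ :=
    mul_nonneg (sq_nonneg x) h3.le
  refine ⟨by linarith, fun h => ?_, fun h => ?_⟩
  · by_contra hx
    have h4 : 0 < x ^ 2 * ((Real.sqrt (a + x ^ 2 + η ^ 2)) ^ 3)⁻¹ :=
      mul_pos (by positivity) h3
    linarith
  · subst h
    simp
end

section
/- Let S ∈ ℝ^{N×R}, y ∈ ℝ^N, μ > 0, η > 0, and a_1,…,a_R ≥ 0. Define f(γ) = (1/2)‖y − Sγ‖₂² + μ Σ_{r=1}^{R} √(a_r + γ_r² + η²), let D₁ be the R×R diagonal matrix with D₁(r,r) = (a_r + η²)^{-1/2}, and define the surrogate g(γ) = f(0) − γ^T S^T y + (1/2) γ^T (S^T S + μ D₁) γ. Then g majorizes f at 0: g(γ) ≥ f(γ) for all γ ∈ ℝ^R, and g(0) = f(0). -/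
open Matrix

/-- The quadratic surrogate g(γ) = f(0) − γᵀSᵀy + ½γᵀ(SᵀS + μD₁)γ majorizes the regularized
objective f at 0: g ≥ f everywhere and g(0) = f(0). -/
theorem online_btd_surrogate_majorizes
    (N R : ℕ) (S : Matrix (Fin N) (Fin R) ℝ) (y : Fin N → ℝ)
    (μ η : ℝ) (hμ : 0 < μ) (hη : 0 < η)
    (a : Fin R → ℝ) (ha : ∀ r, 0 ≤ a r)
    (f : (Fin R → ℝ) → ℝ)
    (hf : ∀ γ, f γ = (1 / 2) * ∑ n : Fin N, (y n - S.mulVec γ n) ^ 2 +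
      μ * ∑ r : Fin R, Real.sqrt (a r + γ r ^ 2 + η ^ 2))
    (D₁ : Matrix (Fin R) (Fin R) ℝ)
    (hD₁ : D₁ = Matrix.diagonal fun r => (Real.sqrt (a r + η ^ 2))⁻¹)
    (g : (Fin R → ℝ) → ℝ)
    (hg : ∀ γ, g γ = f 0 - γ ⬝ᵥ Sᵀ.mulVec y +
      (1 / 2) * γ ⬝ᵥ (Sᵀ * S + μ • D₁).mulVec γ) :
    (∀ γ, f γ ≤ g γ) ∧ g 0 = f 0 := by
  have key : ∀ (b x : ℝ), 0 < b →
      Real.sqrt (b + x ^ 2) ≤ Real.sqrt b + (1 / 2) * (x * ((Real.sqrt b)⁻¹ * x)) := by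
    intro b x hb
    have hs : 0 < Real.sqrt b := Real.sqrt_pos.mpr hb
    have hsq : Real.sqrt b ^ 2 = b := Real.sq_sqrt hb.le
    have hi : Real.sqrt b * (Real.sqrt b)⁻¹ = 1 := mul_inv_cancel₀ hs.ne'
    have hip : 0 < (Real.sqrt b)⁻¹ := inv_pos.mpr hs
    generalize Real.sqrt b = s at *
    generalize s⁻¹ = t at *
    apply Real.sqrt_le_iff.mpr
    constructor
    · nlinarith [mul_nonneg hip.le (sq_nonneg x)]
    · have e : (s + 1 / 2 * (x * (t * x))) ^ 2
          = s ^ 2 + (s * t) * x ^ 2 + (1 / 4) * (x * (t * x)) ^ 2 := by ring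
      rw [e, hi, hsq]
      nlinarith [sq_nonneg (x * (t * x))]
  have hdiag : ∀ γ : Fin R → ℝ, γ ⬝ᵥ D₁ *ᵥ γ
      = ∑ r, γ r * ((Real.sqrt (a r + η ^ 2))⁻¹ * γ r) := by
    intro γ
    simp [hD₁, dotProduct, Matrix.mulVec_diagonal]
  refine ⟨fun γ => ?_, ?_⟩
  · have h1 : γ ⬝ᵥ Sᵀ *ᵥ y = ∑ n, (S *ᵥ γ) n * y n := by
      rw [Matrix.dotProduct_mulVec, Matrix.vecMul_transpose]; rfl
    have h2 : γ ⬝ᵥ (Sᵀ * S) *ᵥ γ = ∑ n, (S *ᵥ γ) n * (S *ᵥ γ) n := by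
      rw [← Matrix.mulVec_mulVec, Matrix.dotProduct_mulVec, Matrix.vecMul_transpose]; rfl
    have h3 : ∑ n, (y n - (S *ᵥ γ) n) ^ 2 = ∑ n, y n ^ 2 - 2 * ∑ n, (S *ᵥ γ) n * y n
        + ∑ n, (S *ᵥ γ) n * (S *ᵥ γ) n := by
      rw [Finset.mul_sum, ← Finset.sum_sub_distrib, ← Finset.sum_add_distrib]
      exact Finset.sum_congr rfl fun n _ => by ring
    have h4 : ∑ r, Real.sqrt (a r + γ r ^ 2 + η ^ 2) ≤ ∑ r, Real.sqrt (a r + η ^ 2)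
        + (1 / 2) * ∑ r, γ r * ((Real.sqrt (a r + η ^ 2))⁻¹ * γ r) := by
      rw [Finset.mul_sum, ← Finset.sum_add_distrib]
      refine Finset.sum_le_sum fun r _ => ?_
      have := key (a r + η ^ 2) (γ r) (by have := ha r; positivity)
      rwa [add_right_comm] at this
    have h5 : f 0 = (1 / 2) * ∑ n, y n ^ 2 + μ * ∑ r, Real.sqrt (a r + η ^ 2) := by
      rw [hf]; simp
    have h6 := mul_le_mul_of_nonneg_left h4 hμ.le
    rw [hg, h5, hf, Matrix.add_mulVec, dotProduct_add, Matrix.smul_mulVec, dotProduct_smul,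
      hdiag, h1, h2, h3, smul_eq_mul]
    linarith
  · rw [hg]; simp
end

section
/- Let S ∈ ℝ^{N×R}, y ∈ ℝ^N, μ > 0, η > 0, and a_1,…,a_R ≥ 0. Define f(γ) = (1/2)‖y − Sγ‖₂² + μ Σ_{r=1}^{R} √(a_r + γ_r² + η²), let D₁ be the R×R diagonal matrix with D₁(r,r) = (a_r + η²)^{-1/2}, and set γ* = (S^T S + μ D₁)^{-1} S^T y. Then f(γ*) ≤ f(0), i.e., the MM update of the C-row does not increase the regularized objective relative to the expansion point 0. -/
open Matrix

/-- Descent property of the MM update of the C-row in O-BTD-RLS: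
with γ* = (SᵀS + μD₁)⁻¹Sᵀy, one has f(γ*) ≤ f(0). -/
theorem online_btd_mm_descent_C_row
    (N R : ℕ) (S : Matrix (Fin N) (Fin R) ℝ) (y : Fin N → ℝ)
    (μ η : ℝ) (hμ : 0 < μ) (hη : 0 < η)
    (a : Fin R → ℝ) (ha : ∀ r, 0 ≤ a r)
    (f : (Fin R → ℝ) → ℝ)
    (hf : ∀ γ, f γ = (1 / 2) * ∑ n : Fin N, (y n - S.mulVec γ n) ^ 2 +
      μ * ∑ r : Fin R, Real.sqrt (a r + γ r ^ 2 + η ^ 2))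
    (D₁ : Matrix (Fin R) (Fin R) ℝ)
    (hD₁ : D₁ = Matrix.diagonal fun r => (Real.sqrt (a r + η ^ 2))⁻¹)
    (γstar : Fin R → ℝ)
    (hγstar : γstar = (Sᵀ * S + μ • D₁)⁻¹.mulVec (Sᵀ.mulVec y)) :
    f γstar ≤ f 0 := by
  have hs : ∀ r, 0 < Real.sqrt (a r + η ^ 2) := fun r =>
    Real.sqrt_pos.2 (by have := ha r; positivity)
  have hD : D₁.PosDef := by
    rw [hD₁]
    exact Matrix.PosDef.diagonal (fun r => inv_pos.2 (hs r))
  have hP : (Sᵀ * S + μ • D₁).PosDef := by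
    have h1 : (Sᵀ * S).PosSemidef := by
      have := Matrix.posSemidef_conjTranspose_mul_self S
      rwa [Matrix.conjTranspose_eq_transpose_of_trivial] at this
    exact Matrix.PosDef.posSemidef_add h1 (hD.smul hμ)
  have hne : (Sᵀ * S + μ • D₁).mulVec γstar = Sᵀ.mulVec y := by
    rw [hγstar, Matrix.mulVec_mulVec, Matrix.mul_nonsing_inv _
      ((Matrix.isUnit_iff_isUnit_det _).1 hP.isUnit), Matrix.one_mulVec]
  have hkey : ∑ n, (S.mulVec γstar n) ^ 2
      + μ * ∑ r, (Real.sqrt (a r + η ^ 2))⁻¹ * γstar r ^ 2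
      = ∑ n, S.mulVec γstar n * y n := by
    have h := congrArg (fun w => γstar ⬝ᵥ w) hne
    simp only [Matrix.add_mulVec, Matrix.smul_mulVec, dotProduct_add, dotProduct_smul,
      ← Matrix.mulVec_mulVec, Matrix.dotProduct_mulVec γstar Sᵀ, Matrix.vecMul_transpose] at h
    rw [hD₁] at h
    simp only [dotProduct, Matrix.mulVec_diagonal, smul_eq_mul] at h
    rw [← h]
    congr 1
    · exact Finset.sum_congr rfl fun n _ => by ring
    · congr 1
      exact Finset.sum_congr rfl fun n _ => by ring
  have hsq : ∑ r, Real.sqrt (a r + γstar r ^ 2 + η ^ 2) ≤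
      ∑ r, Real.sqrt (a r + η ^ 2)
        + (1 / 2) * ∑ r, (Real.sqrt (a r + η ^ 2))⁻¹ * γstar r ^ 2 := by
    rw [Finset.mul_sum, ← Finset.sum_add_distrib]
    refine Finset.sum_le_sum fun r _ => ?_
    have h0 := hs r
    have h2 : Real.sqrt (a r + η ^ 2) ^ 2 = a r + η ^ 2 :=
      Real.sq_sqrt (by have := ha r; positivity)
    set s := Real.sqrt (a r + η ^ 2)
    apply Real.sqrt_le_iff.2
    refine ⟨by positivity, ?_⟩
    have h3 : (s + 1 / 2 * (s⁻¹ * γstar r ^ 2)) ^ 2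
        = s ^ 2 + γstar r ^ 2 + (1 / 2 * (s⁻¹ * γstar r ^ 2)) ^ 2 := by
      field_simp
      ring
    rw [h3, h2]
    nlinarith [sq_nonneg (1 / 2 * (s⁻¹ * γstar r ^ 2))]
  have hexp : ∑ n, (y n - S.mulVec γstar n) ^ 2
      = ∑ n, y n ^ 2 - 2 * ∑ n, S.mulVec γstar n * y n + ∑ n, (S.mulVec γstar n) ^ 2 := by
    rw [Finset.mul_sum, ← Finset.sum_sub_distrib, ← Finset.sum_add_distrib]
    exact Finset.sum_congr rfl fun n _ => by ring
  have hv : 0 ≤ ∑ n, (S.mulVec γstar n) ^ 2 := Finset.sum_nonneg fun n _ => sq_nonneg _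
  have hq : 0 ≤ μ * ∑ r, (Real.sqrt (a r + η ^ 2))⁻¹ * γstar r ^ 2 :=
    mul_nonneg hμ.le (Finset.sum_nonneg fun r _ =>
      mul_nonneg (inv_pos.2 (hs r)).le (sq_nonneg _))
  have hm := mul_le_mul_of_nonneg_left hsq hμ.le
  have hz : f 0 = (1 / 2) * ∑ n, y n ^ 2 + μ * ∑ r, Real.sqrt (a r + η ^ 2) := by
    rw [hf]
    simp
  rw [hz, hf, hexp]
  linarith
end

section
/- Let Y ∈ ℝ^{I×N}, P ∈ ℝ^{N×M}, λ > 0, η > 0, w ∈ ℝ^N with w_n ≥ 0 for all n and W = diag(w), and b ∈ ℝ^M with b_m ≥ 0 for all m. Define f : ℝ^{I×M} → ℝ by f(A) = (1/2) Σ_{n=1}^{N} w_n ‖Y(:,n) − A P(n,:)^T‖₂² + λ Σ_{m=1}^{M} √(‖A(:,m)‖₂² + b_m + η²). Given any A₀ ∈ ℝ^{I×M}, let D be the M×M diagonal matrix with D(m,m) = (‖A₀(:,m)‖₂² + b_m + η²)^{-1/2}, and set A* = Y W P (P^T W P + λ D)^{-1}. Then f(A*) ≤ f(A₀). -/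
open Matrix

/-- Descent guarantee for the MM update of factor A in O-BTD-RLS: with the reweighting
diagonal D built from the previous iterate A₀, the closed-form update
A* = Y W P (PᵀWP + λD)⁻¹ does not increase the exponentially weighted regularized
objective: f(A*) ≤ f(A₀). -/
theorem online_btd_mm_descent_factor_A
    (I N M : ℕ) (Y : Matrix (Fin I) (Fin N) ℝ) (P : Matrix (Fin N) (Fin M) ℝ)
    (lam η : ℝ) (hlam : 0 < lam) (hη : 0 < η)
    (w : Fin N → ℝ) (hw : ∀ n, 0 ≤ w n)
    (W : Matrix (Fin N) (Fin N) ℝ) (hW : W = Matrix.diagonal w)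
    (b : Fin M → ℝ) (hb : ∀ m, 0 ≤ b m)
    (f : Matrix (Fin I) (Fin M) ℝ → ℝ)
    (hf : ∀ A, f A = (1 / 2) * ∑ n : Fin N, w n * ∑ i : Fin I, (Y i n - A.mulVec (P n) i) ^ 2 +
      lam * ∑ m : Fin M, Real.sqrt ((∑ i : Fin I, A i m ^ 2) + b m + η ^ 2))
    (A₀ : Matrix (Fin I) (Fin M) ℝ)
    (D : Matrix (Fin M) (Fin M) ℝ)
    (hD : D = Matrix.diagonal fun m =>
      (Real.sqrt ((∑ i : Fin I, A₀ i m ^ 2) + b m + η ^ 2))⁻¹)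
    (Astar : Matrix (Fin I) (Fin M) ℝ)
    (hAstar : Astar = Y * W * P * (Pᵀ * W * P + lam • D)⁻¹) :
    f Astar ≤ f A₀ := by
  subst hW
  have hu : ∀ (A : Matrix (Fin I) (Fin M) ℝ) m,
      0 < (∑ i : Fin I, A i m ^ 2) + b m + η ^ 2 := by
    intro A m
    have h1 : 0 ≤ ∑ i : Fin I, A i m ^ 2 := Finset.sum_nonneg fun i _ => sq_nonneg _
    have h2 := hb m
    have h3 : 0 < η ^ 2 := by positivity
    linarith
  obtain ⟨d, hd⟩ : ∃ d : Fin M → ℝ, d = fun m =>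
      (Real.sqrt ((∑ i : Fin I, A₀ i m ^ 2) + b m + η ^ 2))⁻¹ := ⟨_, rfl⟩
  rw [← hd] at hD
  have hdpos : ∀ m, 0 < d m := by
    intro m
    rw [hd]
    exact inv_pos.mpr (Real.sqrt_pos.mpr (hu A₀ m))
  subst hD
  -- positive definiteness
  have hPD : (Pᵀ * Matrix.diagonal w * P + lam • Matrix.diagonal d).PosDef := by
    apply Matrix.PosDef.posSemidef_add
    · have h := (Matrix.PosSemidef.diagonal (d := w) hw).conjTranspose_mul_mul_same P
      simpa [Matrix.conjTranspose_eq_transpose_of_trivial] using h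
    · exact (Matrix.PosDef.diagonal hdpos).smul hlam
  have hunit : IsUnit (Pᵀ * Matrix.diagonal w * P + lam • Matrix.diagonal d).det :=
    (Matrix.isUnit_iff_isUnit_det _).mp hPD.isUnit
  have hnormal : Astar * (Pᵀ * Matrix.diagonal w * P + lam • Matrix.diagonal d)
      = Y * Matrix.diagonal w * P := by
    rw [hAstar, Matrix.nonsing_inv_mul_cancel_right _ _ hunit]
  have hent : ∀ i m, (∑ n, w n * (Y i n - Astar.mulVec (P n) i) * P n m)
      = lam * (d m * Astar i m) := by
    intro i m
    have h := congrFun (congrFun hnormal i) m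
    have e1 : (Astar * (Pᵀ * Matrix.diagonal w * P)) i m
        = ∑ n, w n * Astar.mulVec (P n) i * P n m := by
      rw [← Matrix.mul_assoc, ← Matrix.mul_assoc, Matrix.mul_apply]
      refine Finset.sum_congr rfl fun n _ => ?_
      rw [Matrix.mul_diagonal, Matrix.mul_apply]
      simp only [Matrix.mulVec, dotProduct, Matrix.transpose_apply]
      ring
    have e2 : (Astar * (lam • Matrix.diagonal d)) i m = lam * (d m * Astar i m) := by
      rw [Matrix.mul_smul, Matrix.smul_apply, Matrix.mul_diagonal, smul_eq_mul]
      ring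
    have e3 : (Y * Matrix.diagonal w * P) i m = ∑ n, w n * Y i n * P n m := by
      rw [Matrix.mul_apply]
      refine Finset.sum_congr rfl fun n _ => ?_
      rw [Matrix.mul_diagonal]
      ring
    rw [Matrix.mul_add, Matrix.add_apply, e1, e2, e3] at h
    have : (∑ n, w n * (Y i n - Astar.mulVec (P n) i) * P n m)
        = (∑ n, w n * Y i n * P n m) - ∑ n, w n * Astar.mulVec (P n) i * P n m := by
      rw [← Finset.sum_sub_distrib]
      exact Finset.sum_congr rfl fun n _ => by ring
    linarith
  -- the cross terms
  have hcross : ∑ n, w n * ∑ i, (Y i n - Astar.mulVec (P n) i) *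
        (A₀.mulVec (P n) i - Astar.mulVec (P n) i)
      = lam * ∑ m, d m * ∑ i, Astar i m * (A₀ i m - Astar i m) := by
    have l1 : ∑ n, w n * ∑ i, (Y i n - Astar.mulVec (P n) i) *
        (A₀.mulVec (P n) i - Astar.mulVec (P n) i)
        = ∑ n, ∑ i, ∑ m, (A₀ i m - Astar i m) *
          (w n * (Y i n - Astar.mulVec (P n) i) * P n m) := by
      refine Finset.sum_congr rfl fun n _ => ?_
      rw [Finset.mul_sum]
      refine Finset.sum_congr rfl fun i _ => ?_
      have : A₀.mulVec (P n) i - Astar.mulVec (P n) i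
          = ∑ m, (A₀ i m - Astar i m) * P n m := by
        simp only [Matrix.mulVec, dotProduct, ← Finset.sum_sub_distrib, sub_mul]
      rw [this, Finset.mul_sum, Finset.mul_sum]
      exact Finset.sum_congr rfl fun m _ => by ring
    rw [l1, Finset.sum_comm]
    have l2 : ∀ i, ∑ n, ∑ m, (A₀ i m - Astar i m) *
          (w n * (Y i n - Astar.mulVec (P n) i) * P n m)
        = ∑ m, (A₀ i m - Astar i m) * (lam * (d m * Astar i m)) := by
      intro i
      rw [Finset.sum_comm]
      refine Finset.sum_congr rfl fun m _ => ?_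
      rw [← Finset.mul_sum, hent]
    rw [Finset.sum_congr rfl fun i _ => l2 i, Finset.sum_comm, Finset.mul_sum]
    refine Finset.sum_congr rfl fun m _ => ?_
    rw [Finset.mul_sum, Finset.mul_sum]
    exact Finset.sum_congr rfl fun i _ => by ring
  -- quadratic part
  have hquad : (∑ n, w n * ∑ i, (Y i n - Astar.mulVec (P n) i) ^ 2)
      - 2 * (∑ n, w n * ∑ i, (Y i n - Astar.mulVec (P n) i) *
        (A₀.mulVec (P n) i - Astar.mulVec (P n) i))
      ≤ ∑ n, w n * ∑ i, (Y i n - A₀.mulVec (P n) i) ^ 2 := by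
    rw [Finset.mul_sum, ← Finset.sum_sub_distrib]
    refine Finset.sum_le_sum fun n _ => ?_
    have : (∑ i, (Y i n - Astar.mulVec (P n) i) ^ 2)
        - 2 * (∑ i, (Y i n - Astar.mulVec (P n) i) *
          (A₀.mulVec (P n) i - Astar.mulVec (P n) i))
        ≤ ∑ i, (Y i n - A₀.mulVec (P n) i) ^ 2 := by
      rw [Finset.mul_sum, ← Finset.sum_sub_distrib]
      refine Finset.sum_le_sum fun i _ => ?_
      nlinarith [sq_nonneg (A₀.mulVec (P n) i - Astar.mulVec (P n) i)]
    have := mul_le_mul_of_nonneg_left this (hw n)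
    linarith
  -- penalty part
  have hpen : (∑ m, Real.sqrt ((∑ i : Fin I, Astar i m ^ 2) + b m + η ^ 2))
      + ∑ m, d m * ∑ i, Astar i m * (A₀ i m - Astar i m)
      ≤ ∑ m, Real.sqrt ((∑ i : Fin I, A₀ i m ^ 2) + b m + η ^ 2) := by
    rw [← Finset.sum_add_distrib]
    refine Finset.sum_le_sum fun m _ => ?_
    have hdm : d m = (Real.sqrt ((∑ i : Fin I, A₀ i m ^ 2) + b m + η ^ 2))⁻¹ := by rw [hd]
    have hs := Real.sqrt_pos.mpr (hu A₀ m)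
    have hs2 := Real.sq_sqrt (hu A₀ m).le
    have ht2 := Real.sq_sqrt (hu Astar m).le
    have hx : 2 * ∑ i, Astar i m * (A₀ i m - Astar i m)
        ≤ (∑ i, A₀ i m ^ 2) - ∑ i, Astar i m ^ 2 := by
      rw [Finset.mul_sum, ← Finset.sum_sub_distrib]
      refine Finset.sum_le_sum fun i _ => ?_
      nlinarith [sq_nonneg (A₀ i m - Astar i m)]
    rw [hdm]
    set s := Real.sqrt ((∑ i : Fin I, A₀ i m ^ 2) + b m + η ^ 2)
    set t := Real.sqrt ((∑ i : Fin I, Astar i m ^ 2) + b m + η ^ 2)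
    set x := ∑ i, Astar i m * (A₀ i m - Astar i m)
    have hx2 : x ≤ s * (s - t) := by nlinarith [sq_nonneg (s - t)]
    have : s⁻¹ * x ≤ s - t := by
      rw [inv_mul_le_iff₀ hs]
      exact hx2
    linarith
  have hpen2 := mul_le_mul_of_nonneg_left hpen hlam.le
  rw [hf, hf]
  rw [mul_add] at hpen2
  linarith
end
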